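/- arXiv:1706.02394 — 2 statements merged into one kernel-verified Lean document; each statement's English description precedes it below -/
import Mathlib

section
/- (Lemma 2.6) Under the holonomic system hypotheses with the conformally flat constant-mean-curvature ansatz, define α1 := (1/v2) ∂v2/∂u1, α2 := (1/v3) ∂v3/∂u2, α3 := (1/v1) ∂v1/∂u3. If there exist a point p ∈ U and distinct indices i, j ∈ {1,2,3} such that α_i(p) ≠ 0 and α_j(p) ≠ 0, then H = 0 and c = 0. -/
noncomputable section

/-- Partial derivative of `f : ℝ³ → ℝ` in the `i`-th coordinate direction `u_{i+1}`. -/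
noncomputable def pd (i : Fin 3) (f : (Fin 3 → ℝ) → ℝ) (p : Fin 3 → ℝ) : ℝ :=
  fderiv ℝ f p (Pi.single i 1)

/-- `hh v i j p = h_{ij}(p) = (1/v_i) ∂v_j/∂u_i` (indices shifted down by one:
`v 0, v 1, v 2` are `v₁, v₂, v₃` and directions `0,1,2` are `u₁,u₂,u₃`). -/
noncomputable def hh (v : Fin 3 → (Fin 3 → ℝ) → ℝ) (i j : Fin 3) (p : Fin 3 → ℝ) : ℝ :=
  (1 / v i p) * pd i (v j) p

/-- `al v 0 = α₁ = (1/v₂)∂v₂/∂u₁`, `al v 1 = α₂ = (1/v₃)∂v₃/∂u₂`,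
`al v 2 = α₃ = (1/v₁)∂v₁/∂u₃`. -/
noncomputable def al (v : Fin 3 → (Fin 3 → ℝ) → ℝ) (i : Fin 3) (p : Fin 3 → ℝ) : ℝ :=
  (1 / v (i + 1) p) * pd i (v (i + 1)) p

/-- The holonomic system hypotheses together with the conformally flat
constant-mean-curvature ansatz, on a connected open set `U ⊆ ℝ³`. -/
structure Hypo (U : Set (Fin 3 → ℝ)) (v V : Fin 3 → (Fin 3 → ℝ) → ℝ) (c H : ℝ) : Prop where
  hopen : IsOpen U
  hconn : IsConnected U
  smooth_v : ∀ i, ContDiffOn ℝ (⊤ : ℕ∞) (v i) U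
  smooth_V : ∀ i, ContDiffOn ℝ (⊤ : ℕ∞) (V i) U
  pos : ∀ i, ∀ p ∈ U, 0 < v i p
  holi : ∀ i j, i ≠ j → ∀ p ∈ U, pd j (v i) p = hh v j i p * v j p
  holii : ∀ i j k, i ≠ j → j ≠ k → i ≠ k → ∀ p ∈ U,
    pd j (hh v i k) p = hh v i j p * hh v j k p
  holiii : ∀ i j k, i ≠ j → j ≠ k → i ≠ k → ∀ p ∈ U,
    pd i (hh v i j) p + pd j (hh v j i) p + hh v k i p * hh v k j p
      + V i p * V j p + c * v i p * v j p = 0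
  holiv : ∀ i j, i ≠ j → ∀ p ∈ U, pd j (V i) p = hh v j i p * V j p
  ansatz_v : ∀ p ∈ U, (v 1 p) ^ 2 = (v 0 p) ^ 2 + (v 2 p) ^ 2
  ansatz_V1 : ∀ p ∈ U, V 0 p = -(1/3) * (v 1 p / v 2 p + v 2 p / v 1 p) + (v 0 p / 3) * H
  ansatz_V2 : ∀ p ∈ U, V 1 p = -(1/3) * (v 0 p / v 2 p - v 2 p / v 0 p) + (v 1 p / 3) * H
  ansatz_V3 : ∀ p ∈ U, V 2 p = (1/3) * (v 0 p / v 1 p + v 1 p / v 0 p) + (v 2 p / 3) * H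

section PartialDerivatives

variable {f g : (Fin 3 → ℝ) → ℝ} {p : Fin 3 → ℝ} {U : Set (Fin 3 → ℝ)} (i j : Fin 3)

lemma pd_add (hf : DifferentiableAt ℝ f p) (hg : DifferentiableAt ℝ g p) :
    pd i (fun q => f q + g q) p = pd i f p + pd i g p := by
  simp [pd, fderiv_fun_add hf hg]

lemma pd_sub (hf : DifferentiableAt ℝ f p) (hg : DifferentiableAt ℝ g p) :
    pd i (fun q => f q - g q) p = pd i f p - pd i g p := by
  simp [pd, fderiv_fun_sub hf hg]

lemma pd_neg : pd i (fun q => -f q) p = -pd i f p := by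
  simp [pd, fderiv_fun_neg]

lemma pd_mul (hf : DifferentiableAt ℝ f p) (hg : DifferentiableAt ℝ g p) :
    pd i (fun q => f q * g q) p = pd i f p * g p + f p * pd i g p := by
  simp [pd, fderiv_fun_mul hf hg]; ring

lemma pd_pow (n : ℕ) (hf : DifferentiableAt ℝ f p) :
    pd i (fun q => f q ^ n) p = n * f p ^ (n - 1) * pd i f p := by
  simp [pd, fderiv_fun_pow n hf]

lemma pd_const (r : ℝ) : pd i (fun _ => r) p = 0 := by
  simp [pd]

lemma pd_congr_of_eqOn (hU : IsOpen U) (h : ∀ q ∈ U, f q = g q) (hp : p ∈ U) :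
    pd i f p = pd i g p := by
  have : f =ᶠ[nhds p] g := Filter.eventuallyEq_of_mem (hU.mem_nhds hp) h
  simp [pd, this.fderiv_eq]

lemma ContDiffOn.pd (hU : IsOpen U) (hf : ContDiffOn ℝ (⊤ : ℕ∞) f U) :
    ContDiffOn ℝ (⊤ : ℕ∞) (pd i f) U :=
  (hf.fderiv_of_isOpen hU (by simp)).clm_apply contDiffOn_const

lemma pd_comm (hU : IsOpen U) (hf : ContDiffOn ℝ (⊤ : ℕ∞) f U) (hp : p ∈ U) :
    pd i (pd j f) p = pd j (pd i f) p := by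
  have hs : IsSymmSndFDerivAt ℝ f p :=
    (hf.contDiffAt (hU.mem_nhds hp)).isSymmSndFDerivAt (by
      rw [minSmoothness_of_isRCLikeNormedField]
      exact WithTop.coe_le_coe.2 (le_top : (2 : ℕ∞) ≤ ⊤))
  have hd : DifferentiableAt ℝ (fderiv ℝ f) p :=
    ((hf.fderiv_of_isOpen hU (m := (⊤ : ℕ∞)) (by simp)).contDiffAt
      (hU.mem_nhds hp)).differentiableAt (by simp)
  have key : ∀ a b : Fin 3,
      pd a (pd b f) p = fderiv ℝ (fderiv ℝ f) p (Pi.single a 1) (Pi.single b 1) := by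
    intro a b
    change fderiv ℝ (fun q => fderiv ℝ f q (Pi.single b 1)) p (Pi.single a 1) = _
    rw [fderiv_clm_apply hd (differentiableAt_const _)]
    simp
  rw [key, key, hs.eq]

end PartialDerivatives

/-- The signs for which `∑ i, sg i * v i ^ 2` vanishes. -/
def sg : Fin 3 → ℝ := ![1, -1, 1]

lemma sg_sq (i : Fin 3) : sg i * sg i = 1 := by
  fin_cases i <;> simp [sg]

/-- The signed squares of the `v i`, whose sum vanishes. -/
def aa (v : Fin 3 → (Fin 3 → ℝ) → ℝ) (i : Fin 3) (p : Fin 3 → ℝ) : ℝ :=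
  sg i * v i p ^ 2

/-- The reciprocal of `v 0 * v 1 * v 2` up to the sign `e`. -/
def uu (v : Fin 3 → (Fin 3 → ℝ) → ℝ) (e : ℝ) (p : Fin 3 → ℝ) : ℝ :=
  e / (v 0 p * v 1 p * v 2 p)

/-- The rescaled coefficient for which `∂v_i/∂u_j = v_i ^ 5 * be v j` whenever `i ≠ j`. -/
def be (v : Fin 3 → (Fin 3 → ℝ) → ℝ) (j : Fin 3) (p : Fin 3 → ℝ) : ℝ :=
  pd j (v (j + 1)) p / v (j + 1) p ^ 5

/-- The ansatz for `V` in terms of `aa` and `uu`, for a triple of distinct indices `i, j, k`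
of parity `e`. -/
structure Frame (U : Set (Fin 3 → ℝ)) (v V : Fin 3 → (Fin 3 → ℝ) → ℝ) (H e : ℝ)
    (i j k : Fin 3) : Prop where
  ij : i ≠ j
  jk : j ≠ k
  ik : i ≠ k
  sq : e * e = 1
  Vi : ∀ p ∈ U, 3 * V i p = v i p * ((aa v j p - aa v k p) * uu v e p + H)
  Vj : ∀ p ∈ U, 3 * V j p = v j p * ((aa v k p - aa v i p) * uu v e p + H)
  Vk : ∀ p ∈ U, 3 * V k p = v k p * ((aa v i p - aa v j p) * uu v e p + H)

variable {U : Set (Fin 3 → ℝ)} {v V : Fin 3 → (Fin 3 → ℝ) → ℝ} {c H e : ℝ} {i j k : Fin 3}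
  {p : Fin 3 → ℝ}

namespace Frame

lemma rotate (h : Frame U v V H e i j k) : Frame U v V H e j k i :=
  ⟨h.jk, h.ik.symm, h.ij.symm, h.sq, h.Vj, h.Vk, h.Vi⟩

lemma swap (h : Frame U v V H e i j k) : Frame U v V H (-e) j i k where
  ij := h.ij.symm
  jk := h.ik
  ik := h.jk
  sq := by linarith [h.sq]
  Vi p hp := by rw [h.Vj p hp]; simp only [uu]; ring
  Vj p hp := by rw [h.Vi p hp]; simp only [uu]; ring
  Vk p hp := by rw [h.Vk p hp]; simp only [uu]; ring

lemma prod_eq (h : Frame U v V H e i j k) (f : Fin 3 → ℝ) : f 0 * f 1 * f 2 = f i * f j * f k := by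
  have h1 := h.ij
  have h2 := h.jk
  have h3 := h.ik
  clear h
  obtain rfl | rfl | rfl : i = 0 ∨ i = 1 ∨ i = 2 := by omega
  all_goals obtain rfl | rfl | rfl : j = 0 ∨ j = 1 ∨ j = 2 := by omega
  all_goals obtain rfl | rfl | rfl : k = 0 ∨ k = 1 ∨ k = 2 := by omega
  all_goals first | contradiction | ring

lemma sum_eq (h : Frame U v V H e i j k) (f : Fin 3 → ℝ) : f 0 + f 1 + f 2 = f i + f j + f k := by
  have h1 := h.ij
  have h2 := h.jk
  have h3 := h.ik
  clear h
  obtain rfl | rfl | rfl : i = 0 ∨ i = 1 ∨ i = 2 := by omega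
  all_goals obtain rfl | rfl | rfl : j = 0 ∨ j = 1 ∨ j = 2 := by omega
  all_goals obtain rfl | rfl | rfl : k = 0 ∨ k = 1 ∨ k = 2 := by omega
  all_goals first | contradiction | ring

end Frame

namespace Hypo

lemma frame (h : Hypo U v V c H) : Frame U v V H 1 0 1 2 where
  ij := by decide
  jk := by decide
  ik := by decide
  sq := by norm_num
  Vi p hp := by
    have h0 := (h.pos 0 p hp).ne'
    have h1 := (h.pos 1 p hp).ne'
    have h2 := (h.pos 2 p hp).ne'
    rw [h.ansatz_V1 p hp]
    simp [aa, uu, sg]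
    field_simp
    ring
  Vj p hp := by
    have h0 := (h.pos 0 p hp).ne'
    have h1 := (h.pos 1 p hp).ne'
    have h2 := (h.pos 2 p hp).ne'
    rw [h.ansatz_V2 p hp]
    simp [aa, uu, sg]
    field_simp
    ring
  Vk p hp := by
    have h0 := (h.pos 0 p hp).ne'
    have h1 := (h.pos 1 p hp).ne'
    have h2 := (h.pos 2 p hp).ne'
    rw [h.ansatz_V3 p hp]
    simp [aa, uu, sg]
    field_simp

lemma diff_v (h : Hypo U v V c H) (hp : p ∈ U) (i : Fin 3) : DifferentiableAt ℝ (v i) p :=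
  ((h.smooth_v i).contDiffAt (h.hopen.mem_nhds hp)).differentiableAt (by simp)

lemma diff_V (h : Hypo U v V c H) (hp : p ∈ U) (i : Fin 3) : DifferentiableAt ℝ (V i) p :=
  ((h.smooth_V i).contDiffAt (h.hopen.mem_nhds hp)).differentiableAt (by simp)

lemma smooth_be (h : Hypo U v V c H) (i : Fin 3) : ContDiffOn ℝ (⊤ : ℕ∞) (be v i) U :=
  ((h.smooth_v _).pd i h.hopen).div ((h.smooth_v _).pow 5)
    fun p hp => pow_ne_zero _ (h.pos _ p hp).ne'

lemma diff_be (h : Hypo U v V c H) (hp : p ∈ U) (i : Fin 3) : DifferentiableAt ℝ (be v i) p :=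
  ((h.smooth_be i).contDiffAt (h.hopen.mem_nhds hp)).differentiableAt (by simp)

lemma diff_pd_be (h : Hypo U v V c H) (hp : p ∈ U) (i j : Fin 3) :
    DifferentiableAt ℝ (pd j (be v i)) p :=
  (((h.smooth_be i).pd j h.hopen).contDiffAt (h.hopen.mem_nhds hp)).differentiableAt (by simp)

lemma diff_hh (h : Hypo U v V c H) (hp : p ∈ U) (i j : Fin 3) :
    DifferentiableAt ℝ (hh v i j) p := by
  have h1 : DifferentiableAt ℝ (pd i (v j)) p :=
    (((h.smooth_v j).pd i h.hopen).contDiffAt (h.hopen.mem_nhds hp)).differentiableAt (by simp)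
  have h2 := h.diff_v hp i
  have h3 := (h.pos i p hp).ne'
  unfold hh
  fun_prop (disch := assumption)

lemma diff_aa (h : Hypo U v V c H) (hp : p ∈ U) (i : Fin 3) : DifferentiableAt ℝ (aa v i) p := by
  have := h.diff_v hp i
  unfold aa
  fun_prop

lemma diff_uu (h : Hypo U v V c H) (hp : p ∈ U) : DifferentiableAt ℝ (uu v e) p := by
  have h0 := h.diff_v hp
  have h1 : v 0 p * v 1 p * v 2 p ≠ 0 := by
    have := h.pos 0 p hp
    have := h.pos 1 p hp
    have := h.pos 2 p hp
    positivity
  unfold uu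
  fun_prop (disch := assumption)

lemma sum_aa (h : Hypo U v V c H) (F : Frame U v V H e i j k) (hp : p ∈ U) :
    aa v i p + aa v j p + aa v k p = 0 := by
  rw [← F.sum_eq fun m => aa v m p]
  simp only [aa, sg]
  simp
  linarith [h.ansatz_v p hp]

lemma aa_ne (h : Hypo U v V c H) (hp : p ∈ U) (i : Fin 3) : aa v i p ≠ 0 := by
  have h1 : sg i ≠ 0 := left_ne_zero_of_mul_eq_one (sg_sq i)
  exact mul_ne_zero h1 (pow_ne_zero _ (h.pos i p hp).ne')

lemma uu_mul (h : Hypo U v V c H) (F : Frame U v V H e i j k) (hp : p ∈ U) :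
    uu v e p * (v i p * v j p * v k p) = e := by
  have hi := (h.pos i p hp).ne'
  have hj := (h.pos j p hp).ne'
  have hk := (h.pos k p hp).ne'
  rw [uu, F.prod_eq fun m => v m p]
  field_simp

lemma uu_sq (h : Hypo U v V c H) (F : Frame U v V H e i j k) (hp : p ∈ U) :
    uu v e p ^ 2 * (aa v i p * aa v j p * aa v k p) = -1 := by
  have h1 := h.uu_mul F hp
  have h2 : sg i * sg j * sg k = -1 := by
    rw [← F.prod_eq]; simp [sg]
  have h3 := F.sq
  have h4 : (uu v e p * (v i p * v j p * v k p)) ^ 2 * (sg i * sg j * sg k) = -1 := by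
    rw [h1, h2]; linarith
  rw [← h4]
  simp only [aa]
  ring

lemma V_mul (h : Hypo U v V c H) (F : Frame U v V H e i j k) (hp : p ∈ U) :
    3 * V i p * (v j p * v k p)
      = (aa v j p - aa v k p) * e + H * (v i p * v j p * v k p) := by
  rw [F.Vi p hp]
  linear_combination (aa v j p - aa v k p) * h.uu_mul F hp

lemma pd_sum_aa (h : Hypo U v V c H) (F : Frame U v V H e i j k) (hp : p ∈ U) (m : Fin 3) :
    sg i * v i p * pd m (v i) p + sg j * v j p * pd m (v j) p
      + sg k * v k p * pd m (v k) p = 0 := by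
  have hv := h.diff_v hp
  have key := pd_congr_of_eqOn m h.hopen (fun q hq => h.sum_aa F hq) hp
  simp (disch := fun_prop) only [aa, pd_add, pd_mul, pd_pow, pd_const] at key
  norm_num at key
  linear_combination key / 2

lemma pd_V_mul (h : Hypo U v V c H) (F : Frame U v V H e i j k) (hp : p ∈ U) :
    aa v j p * (pd i (v i) p * v k p - pd i (v k) p * v i p) * v j p
      = (aa v j p - aa v k p) * pd i (v j) p * v i p * v k p := by
  have hv := h.diff_v hp
  have hV := h.diff_V hp
  have hi := (h.pos i p hp).ne'
  have hj := (h.pos j p hp).ne'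
  have hk := (h.pos k p hp).ne'
  have key := pd_congr_of_eqOn i h.hopen (fun q hq => h.V_mul F.rotate hq) hp
  have VI := h.V_mul F hp
  have VJ := h.V_mul F.rotate hp
  have VS := h.pd_sum_aa F hp i
  have S := h.sum_aa F hp
  have h4 := h.holiv j i F.ij.symm p hp
  have hY : hh v i j p * v i p = pd i (v j) p := by simp only [hh]; field_simp
  have E := F.sq
  simp (disch := fun_prop) only [aa, pd_add, pd_sub, pd_mul, pd_pow, pd_const] at key
  rw [h4] at key
  norm_num at key
  rw [← hY] at key VS ⊢
  have he : e ≠ 0 := left_ne_zero_of_mul_eq_one E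
  apply mul_left_cancel₀ he
  simp only [aa] at VI VJ S ⊢
  linear_combination (-(v i p * v j p * v k p)) * key + hh v i j p * v i p ^ 2 * v k p * VI
    + v j p * (pd i (v k) p * v i p + pd i (v i) p * v k p) * VJ
    + e * v j p * (pd i (v i) p * v k p - pd i (v k) p * v i p) * S

lemma pd_v_cross (h : Hypo U v V c H) (F : Frame U v V H e i j k) (hp : p ∈ U) :
    v j p ^ 5 * pd i (v k) p = v k p ^ 5 * pd i (v j) p := by
  have hi := (h.pos i p hp).ne'
  have hj := (h.pos j p hp).ne'
  have hk := (h.pos k p hp).ne'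
  have VS := h.pd_sum_aa F hp i
  have S := h.sum_aa F hp
  have key := h.pd_V_mul F hp
  have : aa v j p ^ 2 * v j p * pd i (v k) p = aa v k p ^ 2 * v k p * pd i (v j) p := by
    apply mul_left_cancel₀ hi
    simp only [aa] at key S ⊢
    linear_combination (-(v i p * v j p * v k p * (sg j * v j p ^ 2))) * VS
      + sg i * v i p ^ 2 * key
      + v i p * (sg j * v j p ^ 2 * v j p * pd i (v k) p
        + (sg j * v j p ^ 2 - sg k * v k p ^ 2) * pd i (v j) p * v k p) * S
  simp only [aa] at this
  linear_combination this - v j p ^ 5 * pd i (v k) p * sg_sq j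
    + v k p ^ 5 * pd i (v j) p * sg_sq k

lemma pd_v_diag (h : Hypo U v V c H) (F : Frame U v V H e i j k) (hp : p ∈ U) :
    v j p ^ 5 * pd i (v i) p
      = v i p * (aa v i p ^ 2 - 3 * aa v j p * aa v k p) * pd i (v j) p := by
  have hi := (h.pos i p hp).ne'
  have hj := (h.pos j p hp).ne'
  have hk := (h.pos k p hp).ne'
  have S := h.sum_aa F hp
  have key := h.pd_V_mul F hp
  have key2 := h.pd_v_cross F hp
  apply mul_left_cancel₀ hk
  simp only [aa] at key S ⊢
  linear_combination sg j * v j p ^ 2 * key + v i p * key2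
    - v i p * v k p * pd i (v j) p * (sg i * v i p ^ 2 - sg j * v j p ^ 2 - sg k * v k p ^ 2) * S
    - v j p ^ 5 * (v k p * pd i (v i) p - v i p * pd i (v k) p) * sg_sq j
    - v i p * v k p ^ 5 * pd i (v j) p * sg_sq k

lemma pd_v_of_ne (h : Hypo U v V c H) (hij : i ≠ j) (hp : p ∈ U) :
    pd j (v i) p = v i p ^ 5 * be v j p := by
  have h1 := (h.pos (j + 1) p hp).ne'
  rw [be, ← mul_div_assoc, eq_div_iff (pow_ne_zero _ h1)]
  obtain rfl | rfl : i = j + 1 ∨ i = j + 2 := by omega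
  · ring
  · obtain ⟨e, F⟩ : ∃ e, Frame U v V H e j (j + 1) (j + 2) := by
      obtain rfl | rfl | rfl : j = 0 ∨ j = 1 ∨ j = 2 := by omega
      exacts [⟨1, h.frame⟩, ⟨1, h.frame.rotate⟩, ⟨1, h.frame.rotate.rotate⟩]
    linear_combination h.pd_v_cross F hp

lemma pd_v_self (h : Hypo U v V c H) (F : Frame U v V H e i j k) (hp : p ∈ U) :
    pd i (v i) p = v i p * (aa v i p ^ 2 - 3 * aa v j p * aa v k p) * be v i p := by
  have hj := (h.pos j p hp).ne'
  apply mul_left_cancel₀ (pow_ne_zero 5 hj)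
  rw [h.pd_v_diag F hp, h.pd_v_of_ne F.ij.symm hp]
  ring

lemma pd_aa_of_ne (h : Hypo U v V c H) (hij : i ≠ j) (hp : p ∈ U) :
    pd j (aa v i) p = 2 * aa v i p ^ 3 * be v j p := by
  have hv := h.diff_v hp
  have key : pd j (aa v i) p = pd j (fun q => sg i * v i q ^ 2) p := rfl
  simp (disch := fun_prop) only [pd_mul, pd_pow, pd_const, h.pd_v_of_ne hij hp] at key
  rw [key, aa]
  norm_num
  linear_combination (-2 * v i p ^ 6 * be v j p * sg i) * sg_sq i

lemma pd_aa_self (h : Hypo U v V c H) (F : Frame U v V H e i j k) (hp : p ∈ U) :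
    pd i (aa v i) p
      = 2 * aa v i p * (aa v i p ^ 2 - 3 * aa v j p * aa v k p) * be v i p := by
  have hv := h.diff_v hp
  have key : pd i (aa v i) p = pd i (fun q => sg i * v i q ^ 2) p := rfl
  simp (disch := fun_prop) only [pd_mul, pd_pow, pd_const, h.pd_v_self F hp] at key
  rw [key]
  simp only [aa]
  norm_num
  ring

lemma pd_uu (h : Hypo U v V c H) (F : Frame U v V H e i j k) (hp : p ∈ U) :
    pd i (uu v e) p = -uu v e p
      * (aa v i p ^ 2 + aa v j p ^ 2 + aa v k p ^ 2 - 3 * aa v j p * aa v k p) * be v i p := by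
  have hv := h.diff_v hp
  have hu := h.diff_uu (e := e) hp
  have hi := (h.pos i p hp).ne'
  have hj := (h.pos j p hp).ne'
  have hk := (h.pos k p hp).ne'
  have key := pd_congr_of_eqOn i h.hopen (fun q hq => h.uu_mul F hq) hp
  simp (disch := fun_prop) only [pd_mul, pd_const, h.pd_v_self F hp,
    h.pd_v_of_ne F.ij.symm hp, h.pd_v_of_ne F.ik.symm hp] at key
  apply mul_left_cancel₀ (mul_ne_zero (mul_ne_zero hi hj) hk)
  simp only [aa] at key ⊢
  linear_combination key + v i p * v j p ^ 5 * v k p * uu v e p * be v i p * sg_sq j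
    + v i p * v j p * v k p ^ 5 * uu v e p * be v i p * sg_sq k

lemma hh_mul (h : Hypo U v V c H) (hij : i ≠ j) (hp : p ∈ U) :
    v i p * hh v i j p = v j p ^ 5 * be v i p := by
  have hi := (h.pos i p hp).ne'
  rw [hh, h.pd_v_of_ne hij.symm hp]
  field_simp

lemma pd_be_of_ne (h : Hypo U v V c H) (F : Frame U v V H e i j k) (hp : p ∈ U) :
    pd j (be v i) p
      = be v i p * be v j p * (aa v j p ^ 2 - 5 * aa v k p ^ 2 + aa v i p ^ 2) := by
  have hv := h.diff_v hp
  have hb := h.diff_be hp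
  have hd := h.diff_hh hp
  have key := pd_congr_of_eqOn j h.hopen (fun q hq => h.hh_mul F.ik hq) hp
  simp (disch := fun_prop) only [pd_mul, pd_pow, h.pd_v_of_ne F.ij hp,
    h.pd_v_of_ne F.jk.symm hp, h.holii i j k F.ij F.jk F.ik p hp] at key
  norm_num at key
  have hij := h.hh_mul F.ij hp
  have hjk := h.hh_mul F.jk hp
  have hik := h.hh_mul F.ik hp
  apply mul_left_cancel₀ (pow_ne_zero 5 (h.pos k p hp).ne')
  simp only [aa]
  linear_combination v i p ^ 4 * be v j p * hik + hh v j k p * hij + v j p ^ 4 * be v i p * hjk - key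
    - v k p ^ 5 * be v i p * be v j p * (v j p ^ 4 * sg_sq j - 5 * v k p ^ 4 * sg_sq k
      + v i p ^ 4 * sg_sq i)

lemma holiii_mul (h : Hypo U v V c H) (F : Frame U v V H e i j k) (hp : p ∈ U) :
    sg i * pd i (be v i) p * aa v j p ^ 3 * aa v k p ^ 3
      + sg j * pd j (be v j) p * aa v i p ^ 3 * aa v k p ^ 3
      + aa v k p ^ 3 * (aa v j p ^ 3 * (5 * aa v j p ^ 2 - aa v i p ^ 2 + 3 * aa v j p * aa v k p)
          * (sg i * be v i p ^ 2)
        + aa v i p ^ 3 * (5 * aa v i p ^ 2 - aa v j p ^ 2 + 3 * aa v i p * aa v k p)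
          * (sg j * be v j p ^ 2))
      + aa v i p ^ 3 * aa v j p ^ 3 * aa v k p ^ 2 * (sg k * be v k p ^ 2)
      + (1 / 9) * (-(aa v j p - aa v k p) * (aa v k p - aa v i p) * aa v k p ^ 2
        + (-(aa v i p - aa v j p) * H * uu v e p + (H ^ 2 + 9 * c))
          * aa v i p * aa v j p * aa v k p ^ 3) = 0 := by
  have hv := h.diff_v hp
  have hb := h.diff_be hp
  have hd := h.diff_hh hp
  have key1 := pd_congr_of_eqOn i h.hopen (fun q hq => h.hh_mul F.ij hq) hp
  have key2 := pd_congr_of_eqOn j h.hopen (fun q hq => h.hh_mul F.ij.symm hq) hp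
  simp (disch := fun_prop) only [pd_mul, pd_pow, h.pd_v_self F hp,
    h.pd_v_of_ne F.ij.symm hp] at key1
  simp (disch := fun_prop) only [pd_mul, pd_pow, h.pd_v_self F.swap hp,
    h.pd_v_of_ne F.ij hp] at key2
  have key := h.holiii i j k F.ij F.jk F.ik p hp
  have hij := h.hh_mul F.ij hp
  have hji := h.hh_mul F.ij.symm hp
  have hki := h.hh_mul F.ik.symm hp
  have hkj := h.hh_mul F.jk.symm hp
  have u2 := h.uu_sq F hp
  have hVi := F.Vi p hp
  have hVj := F.Vj p hp
  norm_num at key1 key2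
  simp only [aa] at key1 key2 u2 hVi hVj ⊢
  rcases mul_self_eq_one_iff.1 (sg_sq i) with si | si <;>
  rcases mul_self_eq_one_iff.1 (sg_sq j) with sj | sj <;>
  rcases mul_self_eq_one_iff.1 (sg_sq k) with sk | sk <;>
  linear_combination (norm := (simp only [si, sj, sk]; ring))
    sg i * sg j * (sg k * v k p ^ 2) ^ 3 * (v i p * v j p * key - v j p * key1 - v i p * key2
      + v j p * be v i p * ((sg i * v i p ^ 2) ^ 2 - 3 * (sg j * v j p ^ 2) * (sg k * v k p ^ 2))
        * hij
      + v i p * be v j p * ((sg j * v j p ^ 2) ^ 2 - 3 * (sg i * v i p ^ 2) * (sg k * v k p ^ 2))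
        * hji
      - (1 / 9) * v i p * v j p * (3 * V j p) * hVi
      - (1 / 9) * v i p ^ 2 * v j p
        * ((sg j * v j p ^ 2 - sg k * v k p ^ 2) * uu v e p + H) * hVj)
    - sg i * sg j * sg k * v k p ^ 4 * v i p * v j p * (v k p * hh v k j p * hki
      + v i p ^ 5 * be v k p * hkj)
    - (1 / 9) * (sg j * v j p ^ 2 - sg k * v k p ^ 2) * (sg k * v k p ^ 2 - sg i * v i p ^ 2)
      * (sg k * v k p ^ 2) ^ 2 * u2

end Hypo

/-- The part of the third holonomic equation that is free of second derivatives, after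
multiplication by a monomial in `aa`. -/
def lowerTerm (a b c x y z w K : ℝ) : ℝ :=
  c ^ 3 * (b ^ 3 * (5 * b ^ 2 - a ^ 2 + 3 * b * c) * x + a ^ 3 * (5 * a ^ 2 - b ^ 2 + 3 * a * c) * y)
    + a ^ 3 * b ^ 3 * c ^ 2 * z
    + (1 / 9) * ((c - b) * (c - a) * c ^ 2 + ((b - a) * w + K) * a * b * c ^ 3)

namespace Hypo

/-- The third holonomic equations solved for the pure second derivative in one direction. -/
lemma pd_be_self (h : Hypo U v V c H) (F : Frame U v V H e i j k) (hp : p ∈ U) :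
    2 * sg i * pd i (be v i) p * (aa v j p ^ 3 * aa v k p ^ 3)
      + lowerTerm (aa v i p) (aa v j p) (aa v k p) (sg i * be v i p ^ 2) (sg j * be v j p ^ 2)
          (sg k * be v k p ^ 2) (H * uu v e p) (H ^ 2 + 9 * c)
      + lowerTerm (aa v i p) (aa v k p) (aa v j p) (sg i * be v i p ^ 2) (sg k * be v k p ^ 2)
          (sg j * be v j p ^ 2) (-(H * uu v e p)) (H ^ 2 + 9 * c)
      - lowerTerm (aa v j p) (aa v k p) (aa v i p) (sg j * be v j p ^ 2) (sg k * be v k p ^ 2)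
          (sg i * be v i p ^ 2) (H * uu v e p) (H ^ 2 + 9 * c) = 0 := by
  have h1 := h.holiii_mul F hp
  have h2 := h.holiii_mul F.rotate.rotate.swap hp
  have h3 := h.holiii_mul F.rotate hp
  have hu : uu v (-e) p = -uu v e p := by simp only [uu]; ring
  rw [hu] at h2
  simp only [lowerTerm]
  linear_combination h1 + h2 - h3

/-- The integrability condition `∂_j ∂_i β_i = ∂_i ∂_j β_i` for `β = be v`. -/
lemma compat (h : Hypo U v V c H) (F : Frame U v V H e i j k) (hp : p ∈ U) :
    be v j p * (-10 * (aa v i p * aa v j p ^ 4 * aa v k p ^ 4 * (aa v j p - aa v k p)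
          * (sg i * be v i p ^ 2)
        + aa v j p * aa v k p ^ 4 * aa v i p ^ 4 * (aa v k p - aa v i p) * (sg j * be v j p ^ 2)
        + aa v k p * aa v i p ^ 4 * aa v j p ^ 4 * (aa v i p - aa v j p) * (sg k * be v k p ^ 2))
      + (10 / 9) * (aa v i p * aa v j p * aa v k p)
        * ((aa v i p - aa v j p) * (aa v j p - aa v k p) * (aa v k p - aa v i p))
      - (1 / 18) * (aa v i p * aa v j p * aa v k p) ^ 2
        * (8 * (aa v k p - aa v i p) * (H ^ 2 + 9 * c)
          + (4 * aa v i p ^ 2 - 17 * aa v i p * aa v k p + 4 * aa v k p ^ 2) * (H * uu v e p)))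
      = 0 := by
  have ha := h.diff_aa hp
  have hb := h.diff_be hp
  have hu := h.diff_uu (e := e) hp
  have hpb := h.diff_pd_be hp
  have S := h.sum_aa F hp
  have key := pd_congr_of_eqOn j h.hopen (fun q hq => h.pd_be_self F hq) hp
  have Li := h.pd_be_self F hp
  have Lj := h.pd_be_self F.swap hp
  have mixed := pd_congr_of_eqOn i h.hopen (fun q hq => h.pd_be_of_ne F hq) hp
  have hneg : uu v (-e) p = -uu v e p := by simp only [uu]; ring
  simp (disch := fun_prop) only [pd_add, pd_sub, pd_mul, pd_pow, pd_const, h.pd_aa_self F hp,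
    h.pd_aa_of_ne F.ij.symm hp, h.pd_aa_of_ne F.ik.symm hp, h.pd_be_of_ne F.swap hp] at mixed
  rw [← pd_comm j i h.hopen (h.smooth_be i) hp] at mixed
  simp (disch := fun_prop) only [lowerTerm, pd_add, pd_sub, pd_neg, pd_mul, pd_pow, pd_const,
    h.pd_aa_self F.rotate hp, h.pd_aa_of_ne F.ij hp, h.pd_aa_of_ne F.jk.symm hp,
    h.pd_be_of_ne F hp, h.pd_be_of_ne F.rotate.rotate.swap.rotate hp, h.pd_uu F.rotate hp,
    mixed] at key
  rw [hneg] at Lj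
  simp only [lowerTerm] at Li Lj
  have hk : aa v k p = -aa v i p - aa v j p := by linear_combination S
  norm_num at key
  linear_combination (norm := (simp only [hk]; ring)) -key / 2
    + (aa v j p ^ 2 - 5 * aa v k p ^ 2 + aa v i p ^ 2
      + 6 * (aa v j p ^ 2 - 3 * aa v i p * aa v k p) + 6 * aa v k p ^ 2) * be v j p * Li / 2
    + (5 * (aa v i p ^ 2 - aa v k p ^ 2) + aa v j p ^ 2) * be v j p * Lj / 2

/-- The relation forced by the two integrability conditions for a pair `i, j`. -/
lemma mul_uu_eq (h : Hypo U v V c H) (F : Frame U v V H e i j k) (hp : p ∈ U)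
    (hi : be v i p ≠ 0) (hj : be v j p ≠ 0) :
    7 * H * ((aa v i p - aa v j p) * uu v e p) = 8 * (H ^ 2 + 9 * c) := by
  have h1 := (mul_eq_zero_iff_left hj).1 (h.compat F hp)
  have h2 := (mul_eq_zero_iff_left hi).1 (h.compat F.swap hp)
  have hneg : uu v (-e) p = -uu v e p := by simp only [uu]; ring
  rw [hneg] at h2
  have hk : aa v k p = -aa v i p - aa v j p := by linear_combination h.sum_aa F hp
  apply mul_left_cancel₀ (mul_ne_zero (pow_ne_zero 2 (mul_ne_zero (mul_ne_zero (h.aa_ne hp i)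
    (h.aa_ne hp j)) (h.aa_ne hp k))) (h.aa_ne hp k))
  linear_combination (norm := (simp only [hk]; ring)) 6 * h1 + 6 * h2

/-- The relation of `mul_uu_eq` together with its derivatives gives the vanishing of `H`. -/
lemma eq_zero_of_be_ne (h : Hypo U v V c H) (F : Frame U v V H e i j k) (hp : p ∈ U)
    (hi : be v i p ≠ 0) (hj : be v j p ≠ 0) : H = 0 ∧ c = 0 := by
  have ha := h.diff_aa hp
  have hu := h.diff_uu (e := e) hp
  have hN : IsOpen ((U ∩ be v i ⁻¹' {0}ᶜ) ∩ (U ∩ be v j ⁻¹' {0}ᶜ)) :=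
    ((h.smooth_be i).continuousOn.isOpen_inter_preimage h.hopen isOpen_compl_singleton).inter
      ((h.smooth_be j).continuousOn.isOpen_inter_preimage h.hopen isOpen_compl_singleton)
  have key := fun m => pd_congr_of_eqOn m hN
    (fun q hq => h.mul_uu_eq F hq.1.1 hq.1.2 hq.2.2) ⟨⟨hp, hi⟩, hp, hj⟩
  have h1 := key i
  have h2 := key j
  simp (disch := fun_prop) only [pd_sub, pd_mul, pd_const, h.pd_aa_self F hp,
    h.pd_aa_of_ne F.ij.symm hp, h.pd_uu F hp] at h1
  simp (disch := fun_prop) only [pd_sub, pd_mul, pd_const, h.pd_aa_self F.rotate hp,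
    h.pd_aa_of_ne F.ij hp, h.pd_uu F.rotate hp] at h2
  have hk : aa v k p = -aa v i p - aa v j p := by linear_combination h.sum_aa F hp
  have hu0 : uu v e p ≠ 0 := left_ne_zero_of_mul
    (by rw [h.uu_mul F hp]; exact left_ne_zero_of_mul_eq_one F.sq)
  have hH : H = 0 := by
    apply (mul_eq_zero_iff_right (mul_ne_zero (mul_ne_zero hi hj)
      (mul_ne_zero hu0 (pow_ne_zero 3 (h.aa_ne hp k))))).1
    linear_combination (norm := (simp only [hk]; ring))
      (-1 / 21) * be v j p * h1 + (1 / 21) * be v i p * h2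
  have h3 := h.mul_uu_eq F hp hi hj
  rw [hH] at h3
  exact ⟨hH, by linarith⟩

lemma exists_frame (h : Hypo U v V c H) (hij : i ≠ j) : ∃ e k, Frame U v V H e i j k := by
  have F := h.frame
  obtain rfl | rfl | rfl : i = 0 ∨ i = 1 ∨ i = 2 := by omega
  all_goals obtain rfl | rfl | rfl : j = 0 ∨ j = 1 ∨ j = 2 := by omega
  all_goals first
    | contradiction
    | exact ⟨_, _, F⟩
    | exact ⟨_, _, F.rotate⟩
    | exact ⟨_, _, F.rotate.rotate⟩
    | exact ⟨_, _, F.swap⟩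
    | exact ⟨_, _, F.rotate.swap⟩
    | exact ⟨_, _, F.rotate.rotate.swap⟩

/-- Nonvanishing of `al` gives nonvanishing of `be`. -/
lemma be_ne (h : Hypo U v V c H) (hp : p ∈ U) (hi : al v i p ≠ 0) : be v i p ≠ 0 :=
  div_ne_zero (right_ne_zero_of_mul hi) (pow_ne_zero 5 (h.pos (i + 1) p hp).ne')

end Hypo

theorem statement_8 (U : Set (Fin 3 → ℝ)) (v V : Fin 3 → (Fin 3 → ℝ) → ℝ) (c H : ℝ)
    (hyp : Hypo U v V c H) : (∃ p ∈ U, ∃ i j : Fin 3, i ≠ j ∧ al v i p ≠ 0 ∧ al v j p ≠ 0) →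
    H = 0 ∧ c = 0 := by
  rintro ⟨p, hp, i, j, hij, hi, hj⟩
  obtain ⟨e, k, F⟩ := hyp.exists_frame hij
  exact hyp.eq_zero_of_be_ne F hp (hyp.be_ne hp hi) (hyp.be_ne hp hj)
end
end

section
/- (Analytic form of Theorem 1: there is no conformally flat hypersurface of Q^4(c) with three distinct principal curvatures and nonzero constant mean curvature.) Under the holonomic system hypotheses with the conformally flat constant-mean-curvature ansatz, necessarily H = 0. -/
noncomputable section

open Filter Topology

/-- `f` is differentiable at `p`, with derivative `a` in the direction `x`. -/
def HasDir (x : Fin 3 → ℝ) (f : (Fin 3 → ℝ) → ℝ) (a : ℝ) (p : Fin 3 → ℝ) : Prop :=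
  DifferentiableAt ℝ f p ∧ fderiv ℝ f p x = a

namespace HasDir

variable {x p : Fin 3 → ℝ} {f g : (Fin 3 → ℝ) → ℝ} {a b : ℝ}

theorem eq (hf : HasDir x f a p) (hf' : HasDir x f b p) : a = b := hf.2.symm.trans hf'.2

theorem const (r : ℝ) : HasDir x (fun _ => r) 0 p :=
  ⟨differentiableAt_const r, by simp⟩

theorem add (hf : HasDir x f a p) (hg : HasDir x g b p) :
    HasDir x (fun q => f q + g q) (a + b) p :=
  ⟨hf.1.add hg.1, by rw [fderiv_fun_add hf.1 hg.1]; simp [hf.2, hg.2]⟩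

theorem sub (hf : HasDir x f a p) (hg : HasDir x g b p) :
    HasDir x (fun q => f q - g q) (a - b) p :=
  ⟨hf.1.sub hg.1, by rw [fderiv_fun_sub hf.1 hg.1]; simp [hf.2, hg.2]⟩

theorem mul (hf : HasDir x f a p) (hg : HasDir x g b p) :
    HasDir x (fun q => f q * g q) (f p * b + g p * a) p :=
  ⟨hf.1.mul hg.1, by rw [fderiv_fun_mul hf.1 hg.1]; simp [hf.2, hg.2]⟩

theorem pow (hf : HasDir x f a p) (n : ℕ) :
    HasDir x (fun q => f q ^ n) (n * f p ^ (n - 1) * a) p :=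
  ⟨hf.1.pow n, by rw [fderiv_fun_pow n hf.1]; simp [hf.2]⟩

theorem const_mul (r : ℝ) (hf : HasDir x f a p) : HasDir x (fun q => r * f q) (r * a) p :=
  ⟨hf.1.const_mul r, by rw [fderiv_const_mul hf.1]; simp [hf.2]⟩

theorem inv (hf : HasDir x f a p) (h0 : f p ≠ 0) :
    HasDir x (fun q => (f q)⁻¹) (-a / f p ^ 2) p := by
  have h := (hasDerivAt_inv h0).comp_hasFDerivAt p hf.1.hasFDerivAt
  refine ⟨h.differentiableAt, ?_⟩
  rw [show (fun q => (f q)⁻¹) = (fun y : ℝ => y⁻¹) ∘ f from rfl, h.fderiv]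
  simp [hf.2]; ring

theorem div (hf : HasDir x f a p) (hg : HasDir x g b p) (h0 : g p ≠ 0) :
    HasDir x (fun q => f q / g q) ((a * g p - f p * b) / g p ^ 2) p := by
  have h := hf.mul (hg.inv h0)
  simp only [← div_eq_mul_inv] at h
  refine ⟨h.1, h.2.trans ?_⟩
  field_simp
  ring

theorem congr (hf : HasDir x f a p) (h : g =ᶠ[𝓝 p] f) : HasDir x g a p :=
  ⟨hf.1.congr_of_eventuallyEq h, by rw [h.fderiv_eq, hf.2]⟩

theorem congr_on {U : Set (Fin 3 → ℝ)} (hU : IsOpen U) (hp : p ∈ U) (hf : HasDir x f a p)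
    (h : ∀ q ∈ U, g q = f q) : HasDir x g a p :=
  hf.congr (eventually_of_mem (hU.mem_nhds hp) h)

theorem eq_zero (hf : HasDir x f a p) (h : ∀ᶠ q in 𝓝 p, f q = 0) : a = 0 :=
  hf.eq ((HasDir.const 0).congr h)

end HasDir

theorem fderiv_comm_on {U : Set (Fin 3 → ℝ)} (hU : IsOpen U) {f : (Fin 3 → ℝ) → ℝ}
    (hf : ContDiffOn ℝ (⊤ : ℕ∞) f U) {p : Fin 3 → ℝ} (hp : p ∈ U) (x y : Fin 3 → ℝ) :
    fderiv ℝ (fun q => fderiv ℝ f q x) p y = fderiv ℝ (fun q => fderiv ℝ f q y) p x := by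
  have hc : ContDiffAt ℝ (⊤ : ℕ∞) f p := hf.contDiffAt (hU.mem_nhds hp)
  have hd : DifferentiableAt ℝ (fderiv ℝ f) p :=
    (hc.fderiv_right (m := 1) (WithTop.coe_le_coe.2 le_top)).differentiableAt (by simp)
  have hs : IsSymmSndFDerivAt ℝ f p := hc.isSymmSndFDerivAt (by
    rw [minSmoothness_of_isRCLikeNormedField]; exact WithTop.coe_le_coe.2 le_top)
  have key : ∀ z t : Fin 3 → ℝ,
      fderiv ℝ (fun q => fderiv ℝ f q z) p t = fderiv ℝ (fderiv ℝ f) p t z := by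
    intro z t
    rw [fderiv_clm_apply hd (differentiableAt_const z)]
    simp
  rw [key, key]
  exact hs y x

theorem contDiffOn_fderiv_apply {U : Set (Fin 3 → ℝ)} (hU : IsOpen U) {f : (Fin 3 → ℝ) → ℝ}
    (hf : ContDiffOn ℝ (⊤ : ℕ∞) f U) (x : Fin 3 → ℝ) :
    ContDiffOn ℝ (⊤ : ℕ∞) (fun q => fderiv ℝ f q x) U :=
  (hf.fderiv_of_isOpen hU (by simp)).clm_apply contDiffOn_const

theorem hasDir_fderiv {U : Set (Fin 3 → ℝ)} (hU : IsOpen U) {f : (Fin 3 → ℝ) → ℝ}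
    (hf : ContDiffOn ℝ (⊤ : ℕ∞) f U) {p : Fin 3 → ℝ} (hp : p ∈ U) (x : Fin 3 → ℝ) :
    HasDir x f (fderiv ℝ f p x) p :=
  ⟨(hf.contDiffAt (hU.mem_nhds hp)).differentiableAt (by simp), rfl⟩

/-- The integrated form of the holonomic system: `sᵢ = ± vᵢ²` with `s₁ + s₂ + s₃ = 0`,
`w = 1 / (v₁ v₂ v₃)`, and `bᵢ = vⱼ⁻⁵ ∂vⱼ/∂uᵢ` for `j ≠ i`.
The principal curvatures are `H / 3 + (s₂ - s₃) w / 3` and its cyclic permutations. -/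
structure Sys (U : Set (Fin 3 → ℝ)) (x1 x2 x3 : Fin 3 → ℝ)
    (s1 s2 s3 w b1 b2 b3 : (Fin 3 → ℝ) → ℝ) (e1 e2 e3 c H : ℝ) : Prop where
  isOpen : IsOpen U
  smooth1 : ContDiffOn ℝ (⊤ : ℕ∞) b1 U
  smooth2 : ContDiffOn ℝ (⊤ : ℕ∞) b2 U
  smooth3 : ContDiffOn ℝ (⊤ : ℕ∞) b3 U
  sum : ∀ p ∈ U, s1 p + s2 p + s3 p = 0
  ne1 : ∀ p ∈ U, s1 p ≠ 0
  ne2 : ∀ p ∈ U, s2 p ≠ 0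
  ne3 : ∀ p ∈ U, s3 p ≠ 0
  new : ∀ p ∈ U, w p ≠ 0
  ds11 : ∀ p ∈ U, HasDir x1 s1 (2 * s1 p * (s2 p ^ 2 - s2 p * s3 p + s3 p ^ 2) * b1 p) p
  ds12 : ∀ p ∈ U, HasDir x1 s2 (2 * s2 p ^ 3 * b1 p) p
  ds13 : ∀ p ∈ U, HasDir x1 s3 (2 * s3 p ^ 3 * b1 p) p
  ds22 : ∀ p ∈ U, HasDir x2 s2 (2 * s2 p * (s3 p ^ 2 - s3 p * s1 p + s1 p ^ 2) * b2 p) p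
  ds23 : ∀ p ∈ U, HasDir x2 s3 (2 * s3 p ^ 3 * b2 p) p
  ds21 : ∀ p ∈ U, HasDir x2 s1 (2 * s1 p ^ 3 * b2 p) p
  ds33 : ∀ p ∈ U, HasDir x3 s3 (2 * s3 p * (s1 p ^ 2 - s1 p * s2 p + s2 p ^ 2) * b3 p) p
  ds31 : ∀ p ∈ U, HasDir x3 s1 (2 * s1 p ^ 3 * b3 p) p
  ds32 : ∀ p ∈ U, HasDir x3 s2 (2 * s2 p ^ 3 * b3 p) p
  dw1 : ∀ p ∈ U, HasDir x1 w (-(2 * s2 p ^ 2 - s2 p * s3 p + 2 * s3 p ^ 2) * b1 p * w p) p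
  dw2 : ∀ p ∈ U, HasDir x2 w (-(2 * s3 p ^ 2 - s3 p * s1 p + 2 * s1 p ^ 2) * b2 p * w p) p
  dw3 : ∀ p ∈ U, HasDir x3 w (-(2 * s1 p ^ 2 - s1 p * s2 p + 2 * s2 p ^ 2) * b3 p * w p) p
  db12 : ∀ p ∈ U, HasDir x2 b1 (b1 p * b2 p * (s1 p ^ 2 + s2 p ^ 2 - 5 * s3 p ^ 2)) p
  db23 : ∀ p ∈ U, HasDir x3 b2 (b2 p * b3 p * (s2 p ^ 2 + s3 p ^ 2 - 5 * s1 p ^ 2)) p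
  db31 : ∀ p ∈ U, HasDir x1 b3 (b3 p * b1 p * (s3 p ^ 2 + s1 p ^ 2 - 5 * s2 p ^ 2)) p
  db21 : ∀ p ∈ U, HasDir x1 b2 (b2 p * b1 p * (s1 p ^ 2 + s2 p ^ 2 - 5 * s3 p ^ 2)) p
  db32 : ∀ p ∈ U, HasDir x2 b3 (b3 p * b2 p * (s2 p ^ 2 + s3 p ^ 2 - 5 * s1 p ^ 2)) p
  db13 : ∀ p ∈ U, HasDir x3 b1 (b1 p * b3 p * (s3 p ^ 2 + s1 p ^ 2 - 5 * s2 p ^ 2)) p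
  gauss12 : ∀ p ∈ U,
    s2 p ^ 3 * s3 p * e1 * (fderiv ℝ b1 p x1
        + (5 * s2 p ^ 2 - (s2 p ^ 2 - s2 p * s3 p + s3 p ^ 2)) * b1 p ^ 2)
      + s1 p ^ 3 * s3 p * e2 * (fderiv ℝ b2 p x2
        + (5 * s1 p ^ 2 - (s3 p ^ 2 - s3 p * s1 p + s1 p ^ 2)) * b2 p ^ 2)
      + s1 p ^ 3 * s2 p ^ 3 * e3 * b3 p ^ 2
      + s1 p * s2 p * s3 p * ((H / 3 + (s2 p - s3 p) * w p / 3)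
        * (H / 3 + (s3 p - s1 p) * w p / 3) + c) = 0
  gauss23 : ∀ p ∈ U,
    s3 p ^ 3 * s1 p * e2 * (fderiv ℝ b2 p x2
        + (5 * s3 p ^ 2 - (s3 p ^ 2 - s3 p * s1 p + s1 p ^ 2)) * b2 p ^ 2)
      + s2 p ^ 3 * s1 p * e3 * (fderiv ℝ b3 p x3
        + (5 * s2 p ^ 2 - (s1 p ^ 2 - s1 p * s2 p + s2 p ^ 2)) * b3 p ^ 2)
      + s2 p ^ 3 * s3 p ^ 3 * e1 * b1 p ^ 2
      + s2 p * s3 p * s1 p * ((H / 3 + (s3 p - s1 p) * w p / 3)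
        * (H / 3 + (s1 p - s2 p) * w p / 3) + c) = 0
  gauss31 : ∀ p ∈ U,
    s1 p ^ 3 * s2 p * e3 * (fderiv ℝ b3 p x3
        + (5 * s1 p ^ 2 - (s1 p ^ 2 - s1 p * s2 p + s2 p ^ 2)) * b3 p ^ 2)
      + s3 p ^ 3 * s2 p * e1 * (fderiv ℝ b1 p x1
        + (5 * s3 p ^ 2 - (s2 p ^ 2 - s2 p * s3 p + s3 p ^ 2)) * b1 p ^ 2)
      + s3 p ^ 3 * s1 p ^ 3 * e2 * b2 p ^ 2
      + s3 p * s1 p * s2 p * ((H / 3 + (s1 p - s2 p) * w p / 3)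
        * (H / 3 + (s2 p - s3 p) * w p / 3) + c) = 0

namespace Sys

variable {U : Set (Fin 3 → ℝ)} {x1 x2 x3 : Fin 3 → ℝ}
  {s1 s2 s3 w b1 b2 b3 : (Fin 3 → ℝ) → ℝ} {e1 e2 e3 c H : ℝ}

theorem rotate (S : Sys U x1 x2 x3 s1 s2 s3 w b1 b2 b3 e1 e2 e3 c H) :
    Sys U x2 x3 x1 s2 s3 s1 w b2 b3 b1 e2 e3 e1 c H :=
  ⟨S.isOpen, S.smooth2, S.smooth3, S.smooth1, fun p hp => by linarith [S.sum p hp],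
    S.ne2, S.ne3, S.ne1, S.new, S.ds22, S.ds23, S.ds21, S.ds33, S.ds31, S.ds32, S.ds11, S.ds12,
    S.ds13, S.dw2, S.dw3, S.dw1, S.db23, S.db31, S.db12, S.db32, S.db13, S.db21,
    S.gauss23, S.gauss31, S.gauss12⟩

/-- The three Gauss equations solved for the derivative of `b₁` along `x₁`. -/
theorem fderiv_eq (S : Sys U x1 x2 x3 s1 s2 s3 w b1 b2 b3 e1 e2 e3 c H)
    {p : Fin 3 → ℝ} (hp : p ∈ U) :
    2 * s2 p ^ 2 * s3 p ^ 2 * e1 * (fderiv ℝ b1 p x1 + (s2 p ^ 2 + s3 p ^ 2) * b1 p ^ 2)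
      + s1 p ^ 3 * s3 p ^ 2 * (s2 p - 5 * s1 p + 5 * s3 p) * e2 * b2 p ^ 2
      + s1 p ^ 3 * s2 p ^ 2 * (s3 p - 5 * s1 p + 5 * s2 p) * e3 * b3 p ^ 2
      + s1 p * (s3 p ^ 2 * ((H / 3 + (s2 p - s3 p) * w p / 3)
            * (H / 3 + (s3 p - s1 p) * w p / 3) + c)
          + s2 p ^ 2 * ((H / 3 + (s1 p - s2 p) * w p / 3)
            * (H / 3 + (s2 p - s3 p) * w p / 3) + c)
          - s1 p ^ 2 * ((H / 3 + (s3 p - s1 p) * w p / 3)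
            * (H / 3 + (s1 p - s2 p) * w p / 3) + c)) = 0 := by
  have h12 := S.gauss12 p hp
  have h23 := S.gauss23 p hp
  have h31 := S.gauss31 p hp
  have h3 : s3 p = -s1 p - s2 p := by linarith [S.sum p hp]
  apply mul_left_cancel₀ (mul_ne_zero (S.ne2 p hp) (S.ne3 p hp))
  generalize fderiv ℝ b1 p x1 = T1 at *
  generalize fderiv ℝ b2 p x2 = T2 at *
  generalize fderiv ℝ b3 p x3 = T3 at *
  rw [h3] at h12 h23 h31 ⊢
  linear_combination (s1 p + s2 p) ^ 2 * h12 + s2 p ^ 2 * h31 - s1 p ^ 2 * h23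

/-- The integrability condition for the mixed derivatives of `b₁` along `x₁` and `x₂`. -/
theorem integrability (S : Sys U x1 x2 x3 s1 s2 s3 w b1 b2 b3 e1 e2 e3 c H)
    {p : Fin 3 → ℝ} (hp : p ∈ U) :
    b2 p * (10 * ((s2 p - s3 p) * s2 p ^ 3 * s3 p ^ 3 * e1 * b1 p ^ 2
          + (s3 p - s1 p) * s3 p ^ 3 * s1 p ^ 3 * e2 * b2 p ^ 2
          + (s1 p - s2 p) * s1 p ^ 3 * s2 p ^ 3 * e3 * b3 p ^ 2
          + w p ^ 2 * (s1 p * s2 p * s3 p)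
            * ((s1 p - s2 p) * (s2 p - s3 p) * (s3 p - s1 p)) / 9)
        + s1 p * s2 p * s3 p * (-4 * (s1 p - s3 p) * (c + H ^ 2 / 9)
          + (25 * s1 p ^ 2 + 25 * s1 p * s2 p + 4 * s2 p ^ 2) * H * w p / 18)) = 0 := by
  have hU := S.isOpen
  have hT : HasDir x2 (fun q => fderiv ℝ b1 q x1)
      (fderiv ℝ (fun q => fderiv ℝ b1 q x2) p x1) p :=
    ⟨(hasDir_fderiv hU (contDiffOn_fderiv_apply hU S.smooth1 x1) hp x2).1,
      fderiv_comm_on hU S.smooth1 hp x1 x2⟩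
  have hX := (((hasDir_fderiv hU S.smooth1 hp x1).mul (S.db21 p hp)).mul
    ((((S.ds11 p hp).pow 2).add ((S.ds12 p hp).pow 2)).sub
      (((S.ds13 p hp).pow 2).const_mul 5))).congr_on hU hp
      (g := fun q => fderiv ℝ b1 q x2) (fun q hq => (S.db12 q hq).2)
  rw [hX.2] at hT
  have d1 := S.ds21 p hp
  have d2 := S.ds22 p hp
  have d3 := S.ds23 p hp
  have dw := S.dw2 p hp
  have l1 := ((d2.sub d3).mul dw).const_mul (1 / 3) |>.add (HasDir.const (H / 3))
  have l2 := ((d3.sub d1).mul dw).const_mul (1 / 3) |>.add (HasDir.const (H / 3))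
  have l3 := ((d1.sub d2).mul dw).const_mul (1 / 3) |>.add (HasDir.const (H / 3))
  have D := (((((d2.pow 2).mul (d3.pow 2)).const_mul (2 * e1)).mul
      (hT.add (((d2.pow 2).add (d3.pow 2)).mul ((S.db12 p hp).pow 2)))).add
    ((((d1.pow 3).mul (d3.pow 2)).mul ((d2.sub (d1.const_mul 5)).add (d3.const_mul 5))).mul
      (((hasDir_fderiv hU S.smooth2 hp x2).pow 2).const_mul e2))).add
    ((((d1.pow 3).mul (d2.pow 2)).mul ((d3.sub (d1.const_mul 5)).add (d2.const_mul 5))).mul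
      (((S.db32 p hp).pow 2).const_mul e3)) |>.add
    (d1.mul ((((d3.pow 2).mul ((l1.mul l2).add (HasDir.const c))).add
      ((d2.pow 2).mul ((l3.mul l1).add (HasDir.const c)))).sub
      ((d1.pow 2).mul ((l2.mul l3).add (HasDir.const c)))))
  have D0 := D.eq_zero (eventually_of_mem (hU.mem_nhds hp) fun q hq => by
    have := S.fderiv_eq hq
    linear_combination this)
  have G1 := S.fderiv_eq hp
  have G2 := S.rotate.fderiv_eq hp
  have h3 : s3 p = -s1 p - s2 p := by linarith [S.sum p hp]
  apply mul_left_cancel₀ (mul_ne_zero two_ne_zero (S.ne1 p hp))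
  clear hT hX d1 d2 d3 dw l1 l2 l3 D
  simp only [Nat.cast_ofNat, Nat.add_one_sub_one, pow_one] at D0
  generalize fderiv ℝ b1 p x1 = T1 at *
  generalize fderiv ℝ b2 p x2 = T2 at *
  rw [h3] at D0 G1 G2 ⊢
  generalize s1 p = s at *
  generalize s2 p = t at *
  generalize w p = w at *
  generalize b1 p = b1 at *
  generalize b2 p = b2 at *
  generalize b3 p = b3 at *
  linear_combination D0
    - b2 * (4 * (s ^ 2 + s * (s + t) + (s + t) ^ 2) + 4 * (s + t) ^ 2
      + (s ^ 2 + t ^ 2 - 5 * (s + t) ^ 2)) * G1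
    - s * (-4 * t - 10 * s) * b2 * G2

theorem ne_zero_eventually (S : Sys U x1 x2 x3 s1 s2 s3 w b1 b2 b3 e1 e2 e3 c H)
    {p : Fin 3 → ℝ} (hp : p ∈ U) (h : b1 p ≠ 0) : ∀ᶠ q in 𝓝 p, q ∈ U ∧ b1 q ≠ 0 :=
  (S.isOpen.eventually_mem hp).and
    ((S.smooth1.continuousOn.continuousAt (S.isOpen.mem_nhds hp)).eventually_ne h)

theorem curvature_relation (S : Sys U x1 x2 x3 s1 s2 s3 w b1 b2 b3 e1 e2 e3 c H)
    {p : Fin 3 → ℝ} (hp : p ∈ U) (h1 : b1 p ≠ 0) (h2 : b2 p ≠ 0) :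
    72 * (c + H ^ 2 / 9) - 7 * H * ((s1 p - s2 p) * w p) = 0 := by
  have E12 := (mul_eq_zero.1 (S.integrability hp)).resolve_left h2
  have E31 := (mul_eq_zero.1 (S.rotate.rotate.integrability hp)).resolve_left h1
  have hs := S.sum p hp
  have h3 : s3 p = -s1 p - s2 p := by linarith [S.sum p hp]
  have hn := mul_ne_zero (mul_ne_zero (S.ne1 p hp) (S.ne2 p hp)) (pow_ne_zero 2 (S.ne3 p hp))
  apply mul_left_cancel₀ hn
  rw [h3] at E12 E31 ⊢
  linear_combination 6 * (E12 - E31)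

/-- Two nonvanishing coefficients force the mean curvature to vanish. -/
theorem eq_zero_of_two (S : Sys U x1 x2 x3 s1 s2 s3 w b1 b2 b3 e1 e2 e3 c H)
    {p : Fin 3 → ℝ} (hp : p ∈ U) (h1 : b1 p ≠ 0) (h2 : b2 p ≠ 0) : H = 0 := by
  have ev2 : ∀ᶠ q in 𝓝 p, b2 q ≠ 0 :=
    (S.rotate.ne_zero_eventually hp h2).mono fun q hq => hq.2
  have D := ((HasDir.const (72 * (c + H ^ 2 / 9))).sub
    ((((S.ds11 p hp).sub (S.ds12 p hp)).mul (S.dw1 p hp)).const_mul (7 * H))).eq_zero <| by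
      filter_upwards [S.ne_zero_eventually hp h1, ev2] with q hq hq2
      exact S.curvature_relation hq.1 hq.2 hq2
  have h3 : s1 p = -s2 p - s3 p := by linarith [S.sum p hp]
  have key : H * (s2 p * s3 p ^ 2 * b1 p * w p) = 0 := by
    rw [h3] at D
    linear_combination -D / 21
  refine (mul_eq_zero.1 key).resolve_right ?_
  exact mul_ne_zero (mul_ne_zero (mul_ne_zero (S.ne2 p hp) (pow_ne_zero 2 (S.ne3 p hp))) h1)
    (S.new p hp)

theorem scale_relation (S : Sys U x1 x2 x3 s1 s2 s3 w b1 b2 b3 e1 e2 e3 c H)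
    {p : Fin 3 → ℝ} (hp : p ∈ U) (h1 : b1 p ≠ 0)
    (h2 : ∀ᶠ q in 𝓝 p, b2 q = 0) (h3 : ∀ᶠ q in 𝓝 p, b3 q = 0) :
    H * (4 * s1 p ^ 2 - 21 * (s2 p * s3 p)) - 8 * (w p * ((s2 p - s3 p) * s1 p ^ 2)) = 0 := by
  have T2 : fderiv ℝ b2 p x2 = 0 :=
    (hasDir_fderiv S.isOpen S.smooth2 hp x2).eq_zero h2
  have T3 : fderiv ℝ b3 p x3 = 0 :=
    (hasDir_fderiv S.isOpen S.smooth3 hp x3).eq_zero h3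
  have G2 := S.rotate.fderiv_eq hp
  have G3 := S.rotate.rotate.fderiv_eq hp
  have E := (mul_eq_zero.1 (S.rotate.rotate.integrability hp)).resolve_left h1
  have hs : s1 p = -s2 p - s3 p := by linarith [S.sum p hp]
  rw [T2, h2.self_of_nhds, h3.self_of_nhds] at G2
  rw [T3, h2.self_of_nhds, h3.self_of_nhds] at G3
  rw [h2.self_of_nhds, h3.self_of_nhds] at E
  have hw := S.new p hp
  have n1 := S.ne1 p hp
  have n2 := S.ne2 p hp
  have n3 := S.ne3 p hp
  generalize s1 p = s at *
  generalize s2 p = t at *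
  generalize s3 p = u at *
  generalize w p = w at *
  generalize b1 p = b at *
  apply mul_left_cancel₀ (mul_ne_zero (mul_ne_zero (mul_ne_zero n1 n2) (mul_ne_zero n3 n1)) hw)
  rw [hs] at G2 G3 E ⊢
  linear_combination 6 * (-t - u) * E - 3 * (-t - u) * (t * G3 - u * G2)
    - 15 * (t - u) * (u * G2 + t * G3)

/-- A single nonvanishing coefficient forces the mean curvature to vanish. -/
theorem eq_zero_of_one (S : Sys U x1 x2 x3 s1 s2 s3 w b1 b2 b3 e1 e2 e3 c H)
    {p : Fin 3 → ℝ} (hp : p ∈ U) (h1 : b1 p ≠ 0)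
    (h2 : ∀ᶠ q in 𝓝 p, b2 q = 0) (h3 : ∀ᶠ q in 𝓝 p, b3 q = 0) : H = 0 := by
  have d1 := S.ds11 p hp
  have d2 := S.ds12 p hp
  have d3 := S.ds13 p hp
  have D := (((((d1.pow 2).const_mul 4).sub ((d2.mul d3).const_mul 21)).const_mul H).sub
    (((S.dw1 p hp).mul ((d2.sub d3).mul (d1.pow 2))).const_mul 8)).eq_zero <| by
      filter_upwards [S.ne_zero_eventually hp h1, h2.eventually_nhds, h3.eventually_nhds]
        with q hq hq2 hq3
      exact S.scale_relation hq.1 hq.2 hq2 hq3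
  have R := S.scale_relation hp h1 h2 h3
  have hs : s1 p = -s2 p - s3 p := by linarith [S.sum p hp]
  have n1 := S.ne1 p hp
  simp only [Nat.cast_ofNat, Nat.add_one_sub_one, pow_one] at D
  rw [hs] at D R n1
  have key : H * (b1 p * (s2 p * s3 p) *
      (2 * (s2 p + s3 p) ^ 2 - 7 * (s2 p * s3 p))) = 0 := by
    linear_combination (D - b1 p * (4 * (s2 p + s3 p) ^ 2 - 9 * (s2 p * s3 p)) * R) / 15
  refine (mul_eq_zero.1 key).resolve_right
    (mul_ne_zero (mul_ne_zero h1 (mul_ne_zero (S.ne2 p hp) (S.ne3 p hp))) fun h => n1 ?_)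
  have : (s2 p + s3 p) ^ 2 = 0 := by nlinarith [sq_nonneg (s2 p - s3 p), sq_nonneg (s2 p + s3 p)]
  linarith [pow_eq_zero_iff two_ne_zero |>.1 this]

/-- The coefficients `b₁, b₂, b₃` cannot vanish identically. -/
theorem not_all_zero (S : Sys U x1 x2 x3 s1 s2 s3 w b1 b2 b3 e1 e2 e3 c H)
    {p : Fin 3 → ℝ} (hp : p ∈ U) (h1 : ∀ q ∈ U, b1 q = 0) (h2 : ∀ q ∈ U, b2 q = 0)
    (h3 : ∀ q ∈ U, b3 q = 0) : False := by
  have hU := S.isOpen.mem_nhds hp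
  have T1 : fderiv ℝ b1 p x1 = 0 :=
    (hasDir_fderiv S.isOpen S.smooth1 hp x1).eq_zero (eventually_of_mem hU h1)
  have T2 : fderiv ℝ b2 p x2 = 0 :=
    (hasDir_fderiv S.isOpen S.smooth2 hp x2).eq_zero (eventually_of_mem hU h2)
  have T3 : fderiv ℝ b3 p x3 = 0 :=
    (hasDir_fderiv S.isOpen S.smooth3 hp x3).eq_zero (eventually_of_mem hU h3)
  have g12 := S.gauss12 p hp
  have g23 := S.gauss23 p hp
  have g31 := S.gauss31 p hp
  rw [T1, T2, h1 p hp, h2 p hp, h3 p hp] at g12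
  rw [T2, T3, h1 p hp, h2 p hp, h3 p hp] at g23
  rw [T1, T3, h1 p hp, h2 p hp, h3 p hp] at g31
  have hs : s1 p = -s2 p - s3 p := by linarith [S.sum p hp]
  have n1 := S.ne1 p hp
  have n2 := S.ne2 p hp
  have n3 := S.ne3 p hp
  have hw := S.new p hp
  have l1 : H / 3 + (s2 p - s3 p) * w p / 3 = 0 := by
    apply mul_left_cancel₀ (mul_ne_zero (mul_ne_zero n1 n2) (mul_ne_zero (mul_ne_zero n3 n1) hw))
    rw [hs] at g12 g31 ⊢
    linear_combination g31 - g12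
  have l2 : H / 3 + (s3 p - s1 p) * w p / 3 = 0 := by
    apply mul_left_cancel₀ (mul_ne_zero (mul_ne_zero n1 n2) (mul_ne_zero (mul_ne_zero n3 n2) hw))
    rw [hs] at g12 g23 ⊢
    linear_combination g12 - g23
  exact mul_ne_zero n3 hw (by rw [hs] at l2; linear_combination l2 - l1)

/-- The mean curvature vanishes. -/
theorem eq_zero (S : Sys U x1 x2 x3 s1 s2 s3 w b1 b2 b3 e1 e2 e3 c H) (hne : U.Nonempty) :
    H = 0 := by
  by_contra hH
  have zero_of_ne : ∀ {x1 x2 x3 : Fin 3 → ℝ} {s1 s2 s3 b1 b2 b3 : (Fin 3 → ℝ) → ℝ}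
      {e1 e2 e3 : ℝ}, Sys U x1 x2 x3 s1 s2 s3 w b1 b2 b3 e1 e2 e3 c H → ∀ q ∈ U, b1 q = 0 := by
    intro x1 x2 x3 s1 s2 s3 b1 b2 b3 e1 e2 e3 S q hq
    by_contra h1
    refine hH (S.eq_zero_of_one hq h1 ?_ ?_)
    · filter_upwards [S.ne_zero_eventually hq h1] with r hr
      by_contra h2
      exact hH (S.eq_zero_of_two hr.1 hr.2 h2)
    · filter_upwards [S.ne_zero_eventually hq h1] with r hr
      by_contra h3
      exact hH (S.rotate.rotate.eq_zero_of_two hr.1 h3 hr.2)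
  obtain ⟨p, hp⟩ := hne
  exact S.not_all_zero hp (zero_of_ne S) (zero_of_ne S.rotate) (zero_of_ne S.rotate.rotate)

end Sys

/-- The signs for which `signs i * vᵢ ^ 2` sum to zero. -/
def signs : Fin 3 → ℝ := ![1, -1, 1]

theorem signs_sq (i : Fin 3) : signs i ^ 2 = 1 := by
  fin_cases i <;> simp [signs]

theorem signs_eq (i : Fin 3) : signs i = 1 ∨ signs i = -1 :=
  sq_eq_one_iff.1 (signs_sq i)

/-- The common value of `vⱼ⁻⁵ ∂vⱼ/∂uᵢ` for `j ≠ i`. -/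
def coeff (v : Fin 3 → (Fin 3 → ℝ) → ℝ) (i : Fin 3) (p : Fin 3 → ℝ) : ℝ :=
  pd i (v (i + 1)) p / v (i + 1) p ^ 5

namespace Hypo

variable {U : Set (Fin 3 → ℝ)} {v V : Fin 3 → (Fin 3 → ℝ) → ℝ} {c H : ℝ} {p : Fin 3 → ℝ}

theorem hasDir_v (h : Hypo U v V c H) (hp : p ∈ U) (i j : Fin 3) :
    HasDir (Pi.single i 1) (v j) (pd i (v j) p) p :=
  hasDir_fderiv h.hopen (h.smooth_v j) hp _

theorem pd_constraint (h : Hypo U v V c H) (hp : p ∈ U) (i : Fin 3) :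
    v 1 p * pd i (v 1) p = v 0 p * pd i (v 0) p + v 2 p * pd i (v 2) p := by
  have D := (((h.hasDir_v hp i 1).pow 2).sub
    (((h.hasDir_v hp i 0).pow 2).add ((h.hasDir_v hp i 2).pow 2))).eq_zero
    (eventually_of_mem (h.hopen.mem_nhds hp) fun q hq => by linarith [h.ansatz_v q hq])
  norm_num at D
  linear_combination D / 2

theorem pd_direction_zero (h : Hypo U v V c H) (hp : p ∈ U) :
    pd 0 (v 0) p = v 0 p * (v 1 p ^ 4 + v 1 p ^ 2 * v 2 p ^ 2 + v 2 p ^ 4) * coeff v 0 p ∧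
    pd 0 (v 1) p = v 1 p ^ 5 * coeff v 0 p ∧ pd 0 (v 2) p = v 2 p ^ 5 * coeff v 0 p := by
  have D := (((((h.hasDir_v hp 0 0).div (h.hasDir_v hp 0 2) (h.pos 2 p hp).ne').sub
    ((h.hasDir_v hp 0 2).div (h.hasDir_v hp 0 0) (h.pos 0 p hp).ne')).const_mul (-(1/3))).add
    (((h.hasDir_v hp 0 1).const_mul (1/3)).mul (HasDir.const H))).congr_on h.hopen hp
    (g := V 1) fun q hq => by rw [h.ansatz_V2 q hq]; ring
  have e := h.holiv 1 0 (by decide) p hp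
  rw [pd, D.2, hh, h.ansatz_V1 p hp] at e
  have k := h.pd_constraint hp 0
  have a := h.ansatz_v p hp
  have p0 := (h.pos 0 p hp).ne'
  have p1 := (h.pos 1 p hp).ne'
  have p2 := (h.pos 2 p hp).ne'
  clear D
  simp only [coeff, Fin.reduceAdd]
  generalize pd 0 (v 0) p = y0 at *
  generalize pd 0 (v 1) p = y1 at *
  generalize pd 0 (v 2) p = y2 at *
  generalize v 0 p = v0 at *
  generalize v 1 p = v1 at *
  generalize v 2 p = v2 at *
  obtain ⟨X0, rfl⟩ : ∃ X, y0 = v0 * X := ⟨y0 / v0, by field_simp⟩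
  obtain ⟨X1, rfl⟩ : ∃ X, y1 = v1 * X := ⟨y1 / v1, by field_simp⟩
  obtain ⟨X2, rfl⟩ : ∃ X, y2 = v2 * X := ⟨y2 / v2, by field_simp⟩
  field_simp at e
  have e' : v1 ^ 2 * (X0 - X2) = (v1 ^ 2 + v2 ^ 2) * X1 := by
    linear_combination -e + (X0 - X2) * a
  have r : v1 ^ 4 * X2 = v2 ^ 4 * X1 := by
    linear_combination (v1 ^ 2 * X2 + (v1 ^ 2 + v2 ^ 2) * X1) * a - v1 ^ 2 * k - v0 ^ 2 * e'
  refine ⟨?_, by field_simp, ?_⟩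
  · field_simp
    linear_combination r + v1 ^ 2 * e'
  · field_simp
    linear_combination r

theorem pd_direction_one (h : Hypo U v V c H) (hp : p ∈ U) :
    pd 1 (v 0) p = v 0 p ^ 5 * coeff v 1 p ∧
    pd 1 (v 1) p = v 1 p * (v 2 p ^ 4 - v 2 p ^ 2 * v 0 p ^ 2 + v 0 p ^ 4) * coeff v 1 p ∧
    pd 1 (v 2) p = v 2 p ^ 5 * coeff v 1 p := by
  have D := (((((h.hasDir_v hp 1 1).div (h.hasDir_v hp 1 2) (h.pos 2 p hp).ne').add
    ((h.hasDir_v hp 1 2).div (h.hasDir_v hp 1 1) (h.pos 1 p hp).ne')).const_mul (-(1/3))).add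
    (((h.hasDir_v hp 1 0).const_mul (1/3)).mul (HasDir.const H))).congr_on h.hopen hp
    (g := V 0) fun q hq => by rw [h.ansatz_V1 q hq]; ring
  have e := h.holiv 0 1 (by decide) p hp
  rw [pd, D.2, hh, h.ansatz_V2 p hp] at e
  have k := h.pd_constraint hp 1
  have a := h.ansatz_v p hp
  have p0 := (h.pos 0 p hp).ne'
  have p1 := (h.pos 1 p hp).ne'
  have p2 := (h.pos 2 p hp).ne'
  clear D
  simp only [coeff, Fin.reduceAdd]
  generalize pd 1 (v 0) p = y0 at *
  generalize pd 1 (v 1) p = y1 at *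
  generalize pd 1 (v 2) p = y2 at *
  generalize v 0 p = v0 at *
  generalize v 1 p = v1 at *
  generalize v 2 p = v2 at *
  obtain ⟨X0, rfl⟩ : ∃ X, y0 = v0 * X := ⟨y0 / v0, by field_simp⟩
  obtain ⟨X1, rfl⟩ : ∃ X, y1 = v1 * X := ⟨y1 / v1, by field_simp⟩
  obtain ⟨X2, rfl⟩ : ∃ X, y2 = v2 * X := ⟨y2 / v2, by field_simp⟩
  field_simp at e
  have e' : v0 ^ 2 * (X1 - X2) = (v0 ^ 2 - v2 ^ 2) * X0 := by
    linear_combination -e - (X1 - X2) * a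
  have r : v2 ^ 4 * X0 = v0 ^ 4 * X2 := by
    linear_combination (v0 ^ 2 * X2 + (v0 ^ 2 - v2 ^ 2) * X0) * a - v0 ^ 2 * k + v1 ^ 2 * e'
  refine ⟨?_, ?_, by field_simp⟩
  · field_simp
    linear_combination r
  · field_simp
    apply mul_left_cancel₀ (pow_ne_zero 2 p0)
    linear_combination (v0 ^ 2 - v2 ^ 2) * r + v2 ^ 4 * e'

theorem pd_direction_two (h : Hypo U v V c H) (hp : p ∈ U) :
    pd 2 (v 0) p = v 0 p ^ 5 * coeff v 2 p ∧ pd 2 (v 1) p = v 1 p ^ 5 * coeff v 2 p ∧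
    pd 2 (v 2) p = v 2 p * (v 0 p ^ 4 + v 0 p ^ 2 * v 1 p ^ 2 + v 1 p ^ 4) * coeff v 2 p := by
  have D := (((((h.hasDir_v hp 2 0).div (h.hasDir_v hp 2 2) (h.pos 2 p hp).ne').sub
    ((h.hasDir_v hp 2 2).div (h.hasDir_v hp 2 0) (h.pos 0 p hp).ne')).const_mul (-(1/3))).add
    (((h.hasDir_v hp 2 1).const_mul (1/3)).mul (HasDir.const H))).congr_on h.hopen hp
    (g := V 1) fun q hq => by rw [h.ansatz_V2 q hq]; ring
  have e := h.holiv 1 2 (by decide) p hp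
  rw [pd, D.2, hh, h.ansatz_V3 p hp] at e
  have k := h.pd_constraint hp 2
  have a := h.ansatz_v p hp
  have p0 := (h.pos 0 p hp).ne'
  have p1 := (h.pos 1 p hp).ne'
  have p2 := (h.pos 2 p hp).ne'
  clear D
  simp only [coeff, Fin.reduceAdd]
  generalize pd 2 (v 0) p = y0 at *
  generalize pd 2 (v 1) p = y1 at *
  generalize pd 2 (v 2) p = y2 at *
  generalize v 0 p = v0 at *
  generalize v 1 p = v1 at *
  generalize v 2 p = v2 at *
  obtain ⟨X0, rfl⟩ : ∃ X, y0 = v0 * X := ⟨y0 / v0, by field_simp⟩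
  obtain ⟨X1, rfl⟩ : ∃ X, y1 = v1 * X := ⟨y1 / v1, by field_simp⟩
  obtain ⟨X2, rfl⟩ : ∃ X, y2 = v2 * X := ⟨y2 / v2, by field_simp⟩
  field_simp at e
  have e' : v1 ^ 2 * (X2 - X0) = (v0 ^ 2 + v1 ^ 2) * X1 := by
    linear_combination e + (X2 - X0) * a
  have r : v1 ^ 4 * X0 = v0 ^ 4 * X1 := by
    linear_combination (v1 ^ 2 * X0 + (v0 ^ 2 + v1 ^ 2) * X1) * a - v1 ^ 2 * k - v2 ^ 2 * e'
  refine ⟨by field_simp, ?_, ?_⟩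
  · field_simp
    linear_combination -r
  · field_simp
    apply mul_left_cancel₀ (pow_ne_zero 2 p1)
    linear_combination v0 ^ 4 * e' - (v0 ^ 2 + v1 ^ 2) * r

theorem pd_of_ne (h : Hypo U v V c H) (hp : p ∈ U) {i j : Fin 3} (hij : i ≠ j) :
    pd i (v j) p = v j p ^ 5 * coeff v i p := by
  obtain ⟨-, h01, h02⟩ := h.pd_direction_zero hp
  obtain ⟨h10, -, h12⟩ := h.pd_direction_one hp
  obtain ⟨h20, h21, -⟩ := h.pd_direction_two hp
  fin_cases i <;> fin_cases j <;> first | assumption | exact absurd rfl hij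

theorem pd_self (h : Hypo U v V c H) (hp : p ∈ U) {i j k : Fin 3} (hij : i ≠ j) (hjk : j ≠ k)
    (hik : i ≠ k) :
    pd i (v i) p = v i p * ((signs j * v j p ^ 2) ^ 2
      - signs j * v j p ^ 2 * (signs k * v k p ^ 2) + (signs k * v k p ^ 2) ^ 2)
        * coeff v i p := by
  obtain ⟨h0, -⟩ := h.pd_direction_zero hp
  obtain ⟨-, h1, -⟩ := h.pd_direction_one hp
  obtain ⟨-, -, h2⟩ := h.pd_direction_two hp
  have g0 : signs 0 = 1 := rfl
  have g1 : signs 1 = -1 := rfl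
  have g2 : signs 2 = 1 := rfl
  fin_cases i <;> fin_cases j <;> fin_cases k <;>
    simp only [Fin.zero_eta, Fin.mk_one, Fin.reduceFinMk, ne_eq, not_true_eq_false] at * <;>
    simp only [h0, h1, h2, g0, g1, g2] <;> ring

theorem smooth_coeff (h : Hypo U v V c H) (i : Fin 3) :
    ContDiffOn ℝ (⊤ : ℕ∞) (coeff v i) U :=
  (contDiffOn_fderiv_apply h.hopen (h.smooth_v (i + 1)) _).div ((h.smooth_v (i + 1)).pow 5)
    fun q hq => pow_ne_zero 5 (h.pos _ q hq).ne'

theorem hh_of_ne (h : Hypo U v V c H) (hp : p ∈ U) {i j : Fin 3} (hij : i ≠ j) :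
    hh v i j p = v j p ^ 5 * coeff v i p / v i p := by
  rw [hh, h.pd_of_ne hp hij]
  ring

theorem hasDir_hh (h : Hypo U v V c H) (hp : p ∈ U) {i j : Fin 3} (hij : i ≠ j)
    (k : Fin 3) : HasDir (Pi.single k 1) (hh v i j)
      (((v j p ^ 5 * pd k (coeff v i) p + coeff v i p * (5 * v j p ^ 4 * pd k (v j) p)) * v i p
        - v j p ^ 5 * coeff v i p * pd k (v i) p) / v i p ^ 2) p :=
  ((((h.hasDir_v hp k j).pow 5).mul
    (hasDir_fderiv h.hopen (h.smooth_coeff i) hp (Pi.single k 1))).div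
    (h.hasDir_v hp k i) (h.pos i p hp).ne').congr_on h.hopen hp fun _ hq => h.hh_of_ne hq hij

theorem hasDir_coeff (h : Hypo U v V c H) (hp : p ∈ U) {i j k : Fin 3} (hij : i ≠ j)
    (hjk : j ≠ k) (hik : i ≠ k) :
    HasDir (Pi.single j 1) (coeff v i) (coeff v i p * coeff v j p *
      ((signs i * v i p ^ 2) ^ 2 + (signs j * v j p ^ 2) ^ 2
        - 5 * (signs k * v k p ^ 2) ^ 2)) p := by
  refine ⟨(hasDir_fderiv h.hopen (h.smooth_coeff i) hp (Pi.single j 1)).1, ?_⟩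
  have e := h.holii i j k hij hjk hik p hp
  rw [pd, (h.hasDir_hh hp hik j).2, h.hh_of_ne hp hij, h.hh_of_ne hp hjk, h.pd_of_ne hp hjk,
    h.pd_of_ne hp hij.symm] at e
  have pi := (h.pos i p hp).ne'
  have pj := (h.pos j p hp).ne'
  have pk := (h.pos k p hp).ne'
  change pd j (coeff v i) p = _
  simp only [mul_pow, signs_sq]
  field_simp at e
  linear_combination e

theorem hasDir_self (h : Hypo U v V c H) (hp : p ∈ U) {i j k : Fin 3} (hij : i ≠ j)
    (hjk : j ≠ k) (hik : i ≠ k) :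
    HasDir (Pi.single i 1) (fun q => signs i * v i q ^ 2) (2 * (signs i * v i p ^ 2)
      * ((signs j * v j p ^ 2) ^ 2 - signs j * v j p ^ 2 * (signs k * v k p ^ 2)
        + (signs k * v k p ^ 2) ^ 2) * coeff v i p) p := by
  convert ((h.hasDir_v hp i i).pow 2).const_mul (signs i) using 1
  rw [h.pd_self hp hij hjk hik]
  push_cast
  ring

theorem hasDir_of_ne (h : Hypo U v V c H) (hp : p ∈ U) {i j : Fin 3} (hij : i ≠ j) :
    HasDir (Pi.single i 1) (fun q => signs j * v j q ^ 2)
      (2 * (signs j * v j p ^ 2) ^ 3 * coeff v i p) p := by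
  convert ((h.hasDir_v hp i j).pow 2).const_mul (signs j) using 1
  rw [h.pd_of_ne hp hij]
  push_cast
  linear_combination 2 * signs j * v j p ^ 6 * coeff v i p * signs_sq j

theorem hasDir_inv (h : Hypo U v V c H) (hp : p ∈ U) {i j k : Fin 3} (hij : i ≠ j)
    (hjk : j ≠ k) (hik : i ≠ k) :
    HasDir (Pi.single i 1) (fun q => (v i q * v j q * v k q)⁻¹)
      (-(2 * (signs j * v j p ^ 2) ^ 2 - signs j * v j p ^ 2 * (signs k * v k p ^ 2)
        + 2 * (signs k * v k p ^ 2) ^ 2) * coeff v i p * (v i p * v j p * v k p)⁻¹) p := by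
  have pi := (h.pos i p hp).ne'
  have pj := (h.pos j p hp).ne'
  have pk := (h.pos k p hp).ne'
  convert (((h.hasDir_v hp i i).mul (h.hasDir_v hp i j)).mul (h.hasDir_v hp i k)).inv
    (mul_ne_zero (mul_ne_zero pi pj) pk) using 1
  rw [h.pd_self hp hij hjk hik, h.pd_of_ne hp hij, h.pd_of_ne hp hik]
  simp only [mul_pow, signs_sq]
  field_simp
  ring

theorem gauss (h : Hypo U v V c H) (hp : p ∈ U) {i j k : Fin 3} (hij : i ≠ j)
    (hjk : j ≠ k) (hik : i ≠ k) {s : Fin 3 → ℝ} (hs : ∀ l, s l = signs l * v l p ^ 2)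
    {m n : ℝ} (hm : V i p = v i p * m) (hn : V j p = v j p * n) :
    s j ^ 3 * s k * signs i * (fderiv ℝ (coeff v i) p (Pi.single i 1)
        + (5 * s j ^ 2 - (s j ^ 2 - s j * s k + s k ^ 2)) * coeff v i p ^ 2)
      + s i ^ 3 * s k * signs j * (fderiv ℝ (coeff v j) p (Pi.single j 1)
        + (5 * s i ^ 2 - (s k ^ 2 - s k * s i + s i ^ 2)) * coeff v j p ^ 2)
      + s i ^ 3 * s j ^ 3 * signs k * coeff v k p ^ 2
      + s i * s j * s k * (m * n + c) = 0 := by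
  have e := h.holiii i j k hij hjk hik p hp
  have ei : pd i (hh v i j) p = _ := (h.hasDir_hh hp hij i).2
  have ej : pd j (hh v j i) p = _ := (h.hasDir_hh hp hij.symm j).2
  rw [ei, ej, h.hh_of_ne hp hik.symm, h.hh_of_ne hp hjk.symm, h.pd_self hp hij hjk hik,
    h.pd_self hp hjk hik.symm hij.symm, h.pd_of_ne hp hij, h.pd_of_ne hp hij.symm, hm, hn] at e
  have pi := (h.pos i p hp).ne'
  have pj := (h.pos j p hp).ne'
  have pk := (h.pos k p hp).ne'
  rw [hs, hs, hs]
  refine Eq.trans ?_ (mul_eq_zero_of_right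
    (signs i * signs j * signs k * v i p * v j p * v k p ^ 2) e)
  clear e ei ej
  rw [← pd, ← pd]
  rcases signs_eq i with hi | hi <;> rcases signs_eq j with hj | hj <;>
    rcases signs_eq k with hk | hk <;> rw [hi, hj, hk] <;> field_simp <;> ring


theorem sys (h : Hypo U v V c H) :
    Sys U (Pi.single 0 1) (Pi.single 1 1) (Pi.single 2 1) (fun q => signs 0 * v 0 q ^ 2)
      (fun q => signs 1 * v 1 q ^ 2) (fun q => signs 2 * v 2 q ^ 2)
      (fun q => (v 0 q * v 1 q * v 2 q)⁻¹) (coeff v 0) (coeff v 1) (coeff v 2)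
      (signs 0) (signs 1) (signs 2) c H := by
  have g0 : signs 0 = 1 := rfl
  have g1 : signs 1 = -1 := rfl
  have g2 : signs 2 = 1 := rfl
  have d01 : (0 : Fin 3) ≠ 1 := by decide
  have d12 : (1 : Fin 3) ≠ 2 := by decide
  have d02 : (0 : Fin 3) ≠ 2 := by decide
  have p0 : ∀ q ∈ U, v 0 q ≠ 0 := fun q hq => (h.pos 0 q hq).ne'
  have p1 : ∀ q ∈ U, v 1 q ≠ 0 := fun q hq => (h.pos 1 q hq).ne'
  have p2 : ∀ q ∈ U, v 2 q ≠ 0 := fun q hq => (h.pos 2 q hq).ne'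
  have k0 : ∀ q ∈ U, V 0 q = v 0 q * (H / 3 + (signs 1 * v 1 q ^ 2 - signs 2 * v 2 q ^ 2)
      * (v 0 q * v 1 q * v 2 q)⁻¹ / 3) := fun q hq => by
    have := p0 q hq
    have := p1 q hq
    have := p2 q hq
    rw [h.ansatz_V1 q hq, g1, g2]
    field_simp
    ring
  have k1 : ∀ q ∈ U, V 1 q = v 1 q * (H / 3 + (signs 2 * v 2 q ^ 2 - signs 0 * v 0 q ^ 2)
      * (v 0 q * v 1 q * v 2 q)⁻¹ / 3) := fun q hq => by
    have := p0 q hq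
    have := p1 q hq
    have := p2 q hq
    rw [h.ansatz_V2 q hq, g0, g2]
    field_simp
    ring
  have k2 : ∀ q ∈ U, V 2 q = v 2 q * (H / 3 + (signs 0 * v 0 q ^ 2 - signs 1 * v 1 q ^ 2)
      * (v 0 q * v 1 q * v 2 q)⁻¹ / 3) := fun q hq => by
    have := p0 q hq
    have := p1 q hq
    have := p2 q hq
    rw [h.ansatz_V3 q hq, g0, g1]
    field_simp
    ring
  have w1 (q : Fin 3 → ℝ) : v 0 q * v 1 q * v 2 q = v 1 q * v 2 q * v 0 q := by
    ring
  have w2 (q : Fin 3 → ℝ) : v 0 q * v 1 q * v 2 q = v 2 q * v 0 q * v 1 q := by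
    ring
  exact
  { isOpen := h.hopen
    smooth1 := h.smooth_coeff 0
    smooth2 := h.smooth_coeff 1
    smooth3 := h.smooth_coeff 2
    sum := fun q hq => by
      simp only [g0, g1, g2]
      linarith [h.ansatz_v q hq]
    ne1 := fun q hq => mul_ne_zero (by simp [g0]) (pow_ne_zero 2 (p0 q hq))
    ne2 := fun q hq => mul_ne_zero (by simp [g1]) (pow_ne_zero 2 (p1 q hq))
    ne3 := fun q hq => mul_ne_zero (by simp [g2]) (pow_ne_zero 2 (p2 q hq))
    new := fun q hq => inv_ne_zero (mul_ne_zero (mul_ne_zero (p0 q hq) (p1 q hq)) (p2 q hq))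
    ds11 := fun q hq => h.hasDir_self hq d01 d12 d02
    ds12 := fun q hq => h.hasDir_of_ne hq d01
    ds13 := fun q hq => h.hasDir_of_ne hq d02
    ds22 := fun q hq => h.hasDir_self hq d12 d02.symm d01.symm
    ds23 := fun q hq => h.hasDir_of_ne hq d12
    ds21 := fun q hq => h.hasDir_of_ne hq d01.symm
    ds33 := fun q hq => h.hasDir_self hq d02.symm d01 d12.symm
    ds31 := fun q hq => h.hasDir_of_ne hq d02.symm
    ds32 := fun q hq => h.hasDir_of_ne hq d12.symm
    dw1 := fun q hq => h.hasDir_inv hq d01 d12 d02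
    dw2 := fun q hq => by
      simp only [w1]
      exact h.hasDir_inv hq d12 d02.symm d01.symm
    dw3 := fun q hq => by
      simp only [w2]
      exact h.hasDir_inv hq d02.symm d01 d12.symm
    db12 := fun q hq => h.hasDir_coeff hq d01 d12 d02
    db23 := fun q hq => h.hasDir_coeff hq d12 d02.symm d01.symm
    db31 := fun q hq => h.hasDir_coeff hq d02.symm d01 d12.symm
    db21 := fun q hq => by
      convert h.hasDir_coeff hq d01.symm d02 d12 using 1
      ring
    db32 := fun q hq => by
      convert h.hasDir_coeff hq d12.symm d01.symm d02.symm using 1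
      ring
    db13 := fun q hq => by
      convert h.hasDir_coeff hq d02 d12.symm d01 using 1
      ring
    gauss12 := fun q hq => h.gauss hq d01 d12 d02 (s := fun l => signs l * v l q ^ 2)
      (fun _ => rfl) (k0 q hq) (k1 q hq)
    gauss23 := fun q hq => h.gauss hq d12 d02.symm d01.symm (s := fun l => signs l * v l q ^ 2)
      (fun _ => rfl) (k1 q hq) (k2 q hq)
    gauss31 := fun q hq => h.gauss hq d02.symm d01 d12.symm (s := fun l => signs l * v l q ^ 2)
      (fun _ => rfl) (k2 q hq) (k0 q hq) }

end Hypo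

theorem statement_10 (U : Set (Fin 3 → ℝ)) (v V : Fin 3 → (Fin 3 → ℝ) → ℝ) (c H : ℝ)
    (hyp : Hypo U v V c H) : H = 0 :=
  hyp.sys.eq_zero hyp.hconn.nonempty
end
end
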